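/- For every positive integer K there exist a constant C = C(K) > 0 and an integer n₀ = n₀(K) such that the following holds: if Γ is any group and A ⊆ Γ is a finite subset with |A| ≥ n₀ and |A·A| ≤ K·|A|, then every dissociated subset of A has size at most C·log(|A|)·log(log(|A|)); that is, the additive dimension of A is at most C·log(|A|)·log(log(|A|)). -/

import Mathlib

open Pointwise

/-- A subset `S` of a (not necessarily abelian) group is dissociated if there is no nonempty
ordered product `g₁^{ε₁} ⋯ g_m^{ε_m} = 1` with distinct `g₁, …, g_m ∈ S` and signs
`εᵢ ∈ {1, -1}`. -/
def IsDissociatedMul {Γ : Type*} [Group Γ] (S : Set Γ) : Prop :=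
  ∀ l : List (Γ × ℤ), l ≠ [] → (l.map Prod.fst).Nodup →
    (∀ p ∈ l, p.1 ∈ S) → (∀ p ∈ l, p.2 = 1 ∨ p.2 = -1) →
    (l.map fun p => p.1 ^ p.2).prod ≠ 1

/-- The expectation of `x` over a random subset containing each point independently with
probability `θ`. -/
noncomputable def bernoulliMean {ι : Type*} [Fintype ι] [DecidableEq ι] (x : Finset ι → ℝ)
    (θ : ℝ) : ℝ :=
  ∑ U : Finset ι, (∏ i, if i ∈ U then θ else 1 - θ) * x U

section Russo

variable {ι : Type*} [Fintype ι] [DecidableEq ι]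

lemma sum_finset_eq_sum_erase_insert (g : Finset ι → ℝ) (i : ι) :
    ∑ U : Finset ι, g U = ∑ V ∈ (Finset.univ.erase i).powerset, (g V + g (insert i V)) := by
  have h : (Finset.univ : Finset (Finset ι)) = (insert i (Finset.univ.erase i)).powerset := by
    rw [Finset.insert_erase (Finset.mem_univ i), Finset.powerset_univ]
  rw [h, Finset.sum_powerset_insert (Finset.notMem_erase i _), Finset.sum_add_distrib]

/-- The Margulis-Russo formula. -/
lemma hasDerivAt_bernoulliMean (x : Finset ι → ℝ) (θ : ℝ) :
    HasDerivAt (bernoulliMean x)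
      (bernoulliMean (fun U => ∑ i, (x (insert i U) - x (U.erase i))) θ) θ := by
  have h₁ : HasDerivAt (bernoulliMean x) (∑ U : Finset ι, (∑ i,
      (∏ j ∈ Finset.univ.erase i, if j ∈ U then θ else 1 - θ) • (if i ∈ U then (1 : ℝ) else -1)) *
        x U) θ := by
    unfold bernoulliMean
    refine HasDerivAt.fun_sum fun U _ =>
      HasDerivAt.mul_const (HasDerivAt.fun_finsetProd fun i _ => ?_) _
    split_ifs
    · exact hasDerivAt_id' θ
    · simpa using (hasDerivAt_id' θ).const_sub 1
  convert h₁ using 1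
  unfold bernoulliMean
  simp_rw [Finset.mul_sum, Finset.sum_mul]
  rw [Finset.sum_comm, Finset.sum_comm (s := (Finset.univ : Finset (Finset ι)))]
  refine Finset.sum_congr rfl fun i _ => ?_
  rw [sum_finset_eq_sum_erase_insert _ i, sum_finset_eq_sum_erase_insert _ i]
  refine Finset.sum_congr rfl fun V hV => ?_
  have hi : i ∉ V := fun h => by simpa using Finset.mem_powerset.1 hV h
  have hP : ∏ j ∈ Finset.univ.erase i, (if j ∈ insert i V then θ else 1 - θ) =
      ∏ j ∈ Finset.univ.erase i, if j ∈ V then θ else 1 - θ := by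
    refine Finset.prod_congr rfl fun j hj => ?_
    simp [Finset.ne_of_mem_erase hj]
  rw [← Finset.mul_prod_erase _ _ (Finset.mem_univ i),
    ← Finset.mul_prod_erase _ (fun j => if j ∈ insert i V then θ else 1 - θ) (Finset.mem_univ i),
    hP]
  simp only [hi, Finset.mem_insert_self, if_true, if_false, Finset.insert_idem,
    Finset.erase_insert hi, Finset.erase_eq_of_notMem hi, smul_eq_mul]
  ring

lemma bernoulliMean_mono {x y : Finset ι → ℝ} (h : ∀ U, x U ≤ y U) {θ : ℝ} (h₀ : 0 ≤ θ)
    (h₁ : θ ≤ 1) : bernoulliMean x θ ≤ bernoulliMean y θ := by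
  refine Finset.sum_le_sum fun U _ => mul_le_mul_of_nonneg_left (h U) ?_
  refine Finset.prod_nonneg fun i _ => ?_
  split_ifs <;> linarith

lemma bernoulliMean_zero (x : Finset ι → ℝ) : bernoulliMean x 0 = x ∅ := by
  unfold bernoulliMean
  rw [Finset.sum_eq_single ∅]
  · simp
  · intro U _ hU
    obtain ⟨i, hi⟩ := Finset.nonempty_iff_ne_empty.2 hU
    rw [Finset.prod_eq_zero (Finset.mem_univ i) (by simp [hi]), zero_mul]
  · simp

/-- A function that satisfies a linear differential inequality on the cube decays exponentially. -/
lemma bernoulliMean_half_le {x : Finset ι → ℝ} {k : ℝ}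
    (h : ∀ U, k * x U ≤ ∑ i, (x (U.erase i) - x (insert i U))) :
    bernoulliMean x (1 / 2) ≤ Real.exp (-(k / 2)) * x ∅ := by
  have hd : ∀ θ, HasDerivAt (fun θ => Real.exp (k * θ) * bernoulliMean x θ)
      (Real.exp (k * θ) * k * bernoulliMean x θ + Real.exp (k * θ) *
        bernoulliMean (fun U => ∑ i, (x (insert i U) - x (U.erase i))) θ) θ := fun θ => by
    refine HasDerivAt.mul ?_ (hasDerivAt_bernoulliMean x θ)
    simpa using ((hasDerivAt_id' θ).const_mul k).exp
  have hanti : AntitoneOn (fun θ => Real.exp (k * θ) * bernoulliMean x θ) (Set.Icc 0 (1 / 2)) := by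
    refine antitoneOn_of_hasDerivWithinAt_nonpos (convex_Icc _ _)
      (fun θ _ => (hd θ).continuousAt.continuousWithinAt)
      (fun θ _ => (hd θ).hasDerivWithinAt) fun θ hθ => ?_
    rw [interior_Icc] at hθ
    have := bernoulliMean_mono (x := fun U => ∑ i, (x (insert i U) - x (U.erase i)))
      (y := fun U => - k * x U) (fun U => by
        have := h U
        rw [Finset.sum_sub_distrib] at this ⊢
        linarith) hθ.1.le (hθ.2.le.trans (by norm_num))
    have h2 : bernoulliMean (fun U => - k * x U) θ = -k * bernoulliMean x θ := by
      unfold bernoulliMean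
      rw [Finset.mul_sum]
      exact Finset.sum_congr rfl fun U _ => by ring
    rw [h2] at this
    nlinarith [Real.exp_pos (k * θ)]
  have := hanti (by norm_num : (0 : ℝ) ∈ Set.Icc (0 : ℝ) (1 / 2))
    (by norm_num : (1 / 2 : ℝ) ∈ Set.Icc (0 : ℝ) (1 / 2)) (by norm_num)
  simp only [mul_zero, Real.exp_zero, one_mul, bernoulliMean_zero] at this
  rw [Real.exp_neg, ← div_eq_inv_mul, le_div_iff₀ (Real.exp_pos _), mul_comm]
  convert this using 3
  ring

lemma exists_add_compl_le {x : Finset ι → ℝ} {k : ℝ}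
    (h : ∀ U, k * x U ≤ ∑ i, (x (U.erase i) - x (insert i U))) :
    ∃ U : Finset ι, x U + x Uᶜ ≤ 2 * (Real.exp (-(k / 2)) * x ∅) := by
  by_contra! hc
  have h₁ := bernoulliMean_half_le h
  have hw : ∀ U : Finset ι, (∏ i, if i ∈ U then (1 / 2 : ℝ) else 1 - 1 / 2) =
      (1 / 2) ^ Fintype.card ι := fun U => by
    rw [Finset.prod_congr rfl (g := fun _ => (1 / 2 : ℝ)) (fun i _ => by split_ifs <;> norm_num)]
    simp
  simp only [bernoulliMean, hw] at h₁
  rw [← Finset.mul_sum] at h₁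
  have h₂ : ∑ U : Finset ι, (x U + x Uᶜ) = 2 * ∑ U : Finset ι, x U := by
    rw [Finset.sum_add_distrib, compl_bijective.sum_comp x, two_mul]
  have h₃ := Finset.sum_lt_sum_of_nonempty (Finset.univ_nonempty (α := Finset ι))
    (fun U _ => hc U)
  rw [h₂] at h₃
  simp only [Finset.sum_const, Finset.card_univ, Fintype.card_finset, nsmul_eq_mul] at h₃
  push_cast at h₃
  have h₄ : (1 / 2 : ℝ) ^ Fintype.card ι * 2 ^ Fintype.card ι = 1 := by
    rw [← mul_pow]; norm_num
  have h₅ : (0 : ℝ) < 2 ^ Fintype.card ι := by positivity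
  have h₆ := mul_le_mul_of_nonneg_left h₁ h₅.le
  rw [← mul_assoc, mul_comm (2 ^ _), h₄, one_mul] at h₆
  linarith

end Russo

section Isoperimetry

variable {Γ : Type*} [Group Γ] [DecidableEq Γ]

/-- The elements of `R` that right multiplication by `g` moves into `T`. -/
def movedInto (g : Γ) (R T : Finset Γ) : Finset Γ := R.filter fun r => r * g ∈ T

/-- The elements of `R` that right multiplication by `g` moves out of `R`. -/
def movedOut (g : Γ) (R : Finset Γ) : Finset Γ := R.filter fun r => r * g ∉ R

lemma card_movedInto_inv (g : Γ) (R T : Finset Γ) :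
    (movedInto g⁻¹ R T).card = (movedInto g T R).card := by
  refine Finset.card_nbij' (· * g⁻¹) (· * g) ?_ ?_ ?_ ?_ <;>
    simp +contextual [movedInto, Set.MapsTo, Set.LeftInvOn]

lemma card_movedOut_eq (g : Γ) {R B : Finset Γ} (hR : R ⊆ B) :
    (movedOut g R).card = (movedInto g R (B \ R)).card + (R.filter fun r => r * g ∉ B).card := by
  rw [← Finset.card_union_of_disjoint]
  · congr 1
    ext r
    simp only [movedOut, movedInto, Finset.mem_filter, Finset.mem_union, Finset.mem_sdiff]
    have := @hR (r * g)
    tauto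
  · rw [Finset.disjoint_left]
    simp only [movedInto, Finset.mem_filter, Finset.mem_sdiff]
    tauto

lemma card_movedOut_add_sdiff (g : Γ) {R B : Finset Γ} (hR : R ⊆ B) :
    (movedOut g R).card + (movedOut g (B \ R)).card =
      (movedOut g B).card + ((movedInto g R (B \ R)).card + (movedInto g⁻¹ R (B \ R)).card) := by
  rw [card_movedOut_eq g hR, card_movedOut_eq g (Finset.sdiff_subset : B \ R ⊆ B),
    sdiff_sdiff_right_self, Finset.inf_eq_inter, Finset.inter_eq_right.2 hR, card_movedInto_inv]
  have : (movedOut g B).card = (R.filter fun r => r * g ∉ B).card +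
      ((B \ R).filter fun r => r * g ∉ B).card := by
    rw [movedOut, ← Finset.card_union_of_disjoint, ← Finset.filter_union,
      Finset.union_sdiff_of_subset hR]
    exact Finset.disjoint_filter_filter Finset.disjoint_sdiff
  omega

/-- The entropy-penalised average number of pairs in `B × p` that leave `B`. -/
noncomputable def penalizedBoundary {ι : Type*} [Fintype ι] (p : ι → Γ) (k : ℝ) (B : Finset Γ) :
    ℝ :=
  k * Real.log B.card + (∑ i, ((movedOut (p i) B).card : ℝ)) / B.card

lemma card_mul_penalizedBoundary {ι : Type*} [Fintype ι] (p : ι → Γ) (k : ℝ) {B : Finset Γ}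
    (hB : B.Nonempty) : B.card * penalizedBoundary p k B =
      k * (B.card * Real.log B.card) + ∑ i, ((movedOut (p i) B).card : ℝ) := by
  have : (B.card : ℝ) ≠ 0 := by exact_mod_cast hB.card_ne_zero
  unfold penalizedBoundary
  field_simp

/-- Minimisers of `penalizedBoundary` satisfy an edge-isoperimetric inequality. -/
lemma isoperimetry_of_minimal {ι : Type*} [Fintype ι] (p : ι → Γ) {k : ℝ} (hk : 0 ≤ k)
    {B : Finset Γ}
    (hmin : ∀ R ⊆ B, R.Nonempty → penalizedBoundary p k B ≤ penalizedBoundary p k R)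
    {R : Finset Γ} (hRB : R ⊆ B) (hR : R.Nonempty) :
    k * (R.card * (Real.log B.card - Real.log R.card)) ≤
      ∑ i, (((movedInto (p i) R (B \ R)).card : ℝ) + (movedInto (p i)⁻¹ R (B \ R)).card) := by
  rcases (B \ R).eq_empty_or_nonempty with hT | hT
  · rw [hRB.antisymm (Finset.sdiff_eq_empty_iff_subset.1 hT)]
    simp only [sub_self, mul_zero]
    positivity
  have hcard : ((B \ R).card : ℝ) + R.card = B.card := by
    exact_mod_cast Finset.card_sdiff_add_card_eq_card hRB
  have hE : (∑ i, ((movedOut (p i) R).card : ℝ)) + ∑ i, ((movedOut (p i) (B \ R)).card : ℝ) =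
      (∑ i, ((movedOut (p i) B).card : ℝ)) +
      ∑ i, (((movedInto (p i) R (B \ R)).card : ℝ) + (movedInto (p i)⁻¹ R (B \ R)).card) := by
    rw [← Finset.sum_add_distrib, ← Finset.sum_add_distrib]
    exact Finset.sum_congr rfl fun i _ => by exact_mod_cast card_movedOut_add_sdiff (p i) hRB
  have h₁ := mul_le_mul_of_nonneg_left (hmin R hRB hR) (Nat.cast_nonneg (α := ℝ) R.card)
  have h₂ := mul_le_mul_of_nonneg_left (hmin _ Finset.sdiff_subset hT)
    (Nat.cast_nonneg (α := ℝ) (B \ R).card)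
  have h₃ := card_mul_penalizedBoundary p k (hR.mono hRB)
  rw [card_mul_penalizedBoundary p k hR] at h₁
  rw [card_mul_penalizedBoundary p k hT] at h₂
  rw [← hcard, add_mul, hcard] at h₃
  have h₄ : 0 ≤ k * ((B \ R).card * (Real.log B.card - Real.log (B \ R).card)) := by
    refine mul_nonneg hk (mul_nonneg (Nat.cast_nonneg _) (sub_nonneg.2 ?_))
    refine Real.log_le_log (by exact_mod_cast hT.card_pos) ?_
    exact_mod_cast Finset.card_le_card Finset.sdiff_subset
  rw [← hcard] at h₃ h₄ ⊢
  linarith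

lemma exists_minimal_penalizedBoundary {ι : Type*} [Fintype ι] (p : ι → Γ) (k : ℝ)
    {A : Finset Γ} (hA : A.Nonempty) :
    ∃ B ⊆ A, B.Nonempty ∧ penalizedBoundary p k B ≤ penalizedBoundary p k A ∧
      ∀ R ⊆ B, R.Nonempty → penalizedBoundary p k B ≤ penalizedBoundary p k R := by
  obtain ⟨B, hB, hmin⟩ := Finset.exists_min_image (A.powerset.filter Finset.Nonempty)
    (penalizedBoundary p k) ⟨A, by simpa using hA⟩
  simp only [Finset.mem_filter, Finset.mem_powerset] at hB hmin
  exact ⟨B, hB.1, hB.2, hmin A ⟨subset_rfl, hA⟩, fun R hR hR' => hmin R ⟨hR.trans hB.1, hR'⟩⟩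

end Isoperimetry

section SignedWords

variable {Γ ι : Type*} [Group Γ]

/-- A list of indices in `U`, without repetition, each carrying a sign. -/
def IsSignedWord (U : Set ι) (l : List (ι × ℤ)) : Prop :=
  (l.map Prod.fst).Nodup ∧ (∀ q ∈ l, q.1 ∈ U) ∧ ∀ q ∈ l, q.2 = 1 ∨ q.2 = -1

/-- The value of a signed word in a family of group elements. -/
def wordProd (p : ι → Γ) (l : List (ι × ℤ)) : Γ := (l.map fun q => p q.1 ^ q.2).prod

/-- A family of group elements is dissociated if nonempty signed words have nontrivial values. -/
def IsDissociatedFamily (p : ι → Γ) : Prop :=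
  ∀ l, l ≠ [] → IsSignedWord Set.univ l → wordProd p l ≠ 1

lemma IsSignedWord.mono {U V : Set ι} {l : List (ι × ℤ)} (h : IsSignedWord U l) (hUV : U ⊆ V) :
    IsSignedWord V l :=
  ⟨h.1, fun q hq => hUV (h.2.1 q hq), h.2.2⟩

lemma IsSignedWord.append {U V : Set ι} {l m : List (ι × ℤ)} (hl : IsSignedWord U l)
    (hm : IsSignedWord V m) (hUV : Disjoint U V) : IsSignedWord (U ∪ V) (l ++ m) := by
  refine ⟨?_, ?_, ?_⟩
  · rw [List.map_append]
    refine hl.1.append hm.1 ?_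
    intro a ha hb
    obtain ⟨q, hq, rfl⟩ := List.mem_map.1 ha
    obtain ⟨r, hr, hrq⟩ := List.mem_map.1 hb
    exact hUV.le_bot ⟨hl.2.1 q hq, hrq ▸ hm.2.1 r hr⟩
  · intro q hq
    rcases List.mem_append.1 hq with h | h
    exacts [Or.inl (hl.2.1 q h), Or.inr (hm.2.1 q h)]
  · intro q hq
    rcases List.mem_append.1 hq with h | h
    exacts [hl.2.2 q h, hm.2.2 q h]

lemma isSignedWord_singleton (i : ι) {s : ℤ} (hs : s = 1 ∨ s = -1) :
    IsSignedWord {i} [(i, s)] := by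
  simpa [IsSignedWord] using hs

/-- The formal inverse of a signed word. -/
def wordInv (l : List (ι × ℤ)) : List (ι × ℤ) := (l.map fun q => (q.1, -q.2)).reverse

lemma IsSignedWord.wordInv {U : Set ι} {l : List (ι × ℤ)} (h : IsSignedWord U l) :
    IsSignedWord U (wordInv l) := by
  refine ⟨?_, ?_, ?_⟩
  · have : (_root_.wordInv l).map Prod.fst = (l.map Prod.fst).reverse := by
      simp [_root_.wordInv, Function.comp_def]
    rw [this]
    exact List.nodup_reverse.2 h.1
  · intro q hq
    obtain ⟨r, hr, rfl⟩ : ∃ r ∈ l, (r.1, -r.2) = q := by simpa [_root_.wordInv] using hq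
    exact h.2.1 r hr
  · intro q hq
    obtain ⟨r, hr, rfl⟩ : ∃ r ∈ l, (r.1, -r.2) = q := by simpa [_root_.wordInv] using hq
    rcases h.2.2 r hr with h | h <;> simp [h]

lemma wordProd_append (p : ι → Γ) (l m : List (ι × ℤ)) :
    wordProd p (l ++ m) = wordProd p l * wordProd p m := by
  simp [wordProd]

lemma wordProd_wordInv (p : ι → Γ) (l : List (ι × ℤ)) :
    wordProd p (wordInv l) = (wordProd p l)⁻¹ := by
  simp [wordProd, wordInv, List.prod_inv_reverse, Function.comp_def]

/-- In a dissociated family, words over disjoint sets of indices with equal values are empty. -/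
lemma IsDissociatedFamily.eq_nil {p : ι → Γ} (hp : IsDissociatedFamily p) {U V : Set ι}
    (hUV : Disjoint U V) {l m : List (ι × ℤ)} (hl : IsSignedWord U l) (hm : IsSignedWord V m)
    (h : wordProd p l = wordProd p m) : l = [] := by
  by_contra hne
  refine hp (l ++ wordInv m) (by simp [hne])
    ((hl.append hm.wordInv hUV).mono (Set.subset_univ _)) ?_
  rw [wordProd_append, wordProd_wordInv, h, mul_inv_cancel]

open Classical in
/-- The points of `B` of the form `b * w`, where `w` is the value of a signed word over `U`. -/
noncomputable def reachable (p : ι → Γ) (B : Finset Γ) (b : Γ) (U : Set ι) : Finset Γ :=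
  B.filter fun y => ∃ l, IsSignedWord U l ∧ y = b * wordProd p l

lemma reachable_subset (p : ι → Γ) (B : Finset Γ) (b : Γ) (U : Set ι) :
    reachable p B b U ⊆ B := by
  classical exact Finset.filter_subset _ _

lemma self_mem_reachable (p : ι → Γ) {B : Finset Γ} {b : Γ} (hb : b ∈ B) (U : Set ι) :
    b ∈ reachable p B b U := by
  classical
  refine Finset.mem_filter.2 ⟨hb, [], ?_, ?_⟩ <;> simp [IsSignedWord, wordProd]

lemma reachable_mono (p : ι → Γ) (B : Finset Γ) (b : Γ) {U V : Set ι} (hUV : U ⊆ V) :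
    reachable p B b U ⊆ reachable p B b V := by
  classical
  intro y hy
  obtain ⟨hyB, l, hl, h⟩ := Finset.mem_filter.1 hy
  exact Finset.mem_filter.2 ⟨hyB, l, hl.mono hUV, h⟩

lemma mul_zpow_mem_reachable {p : ι → Γ} {B : Finset Γ} {b y : Γ} {U : Set ι} {i : ι}
    (hi : i ∉ U) {s : ℤ} (hs : s = 1 ∨ s = -1) (hy : y ∈ reachable p B b U)
    (hyB : y * p i ^ s ∈ B) : y * p i ^ s ∈ reachable p B b (insert i U) := by
  classical
  obtain ⟨-, l, hl, rfl⟩ := Finset.mem_filter.1 hy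
  refine Finset.mem_filter.2 ⟨hyB, l ++ [(i, s)], ?_, ?_⟩
  · rw [Set.insert_eq, Set.union_comm]
    exact hl.append (isSignedWord_singleton i hs) (by simpa using hi)
  · rw [wordProd_append, mul_assoc]
    simp [wordProd]

lemma eq_of_mem_reachable_of_disjoint {p : ι → Γ} (hp : IsDissociatedFamily p) {B : Finset Γ}
    {b y : Γ} {U V : Set ι} (hUV : Disjoint U V) (hU : y ∈ reachable p B b U)
    (hV : y ∈ reachable p B b V) : y = b := by
  classical
  obtain ⟨-, l, hl, h⟩ := Finset.mem_filter.1 hU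
  obtain ⟨-, m, hm, h'⟩ := Finset.mem_filter.1 hV
  rw [hp.eq_nil hUV hl hm (mul_left_cancel (h.symm.trans h'))] at h
  simpa [wordProd] using h

end SignedWords

section LogDeficit

lemma min_sub_div_le_log {a b : ℝ} (ha : 0 < a) (hab : a ≤ b) :
    min (b - a) a / a ≤ 2 * (Real.log b - Real.log a) := by
  have hb := ha.trans_le hab
  have h := Real.one_sub_inv_le_log_of_pos (div_pos hb ha)
  rw [Real.log_div hb.ne' ha.ne', inv_div] at h
  refine le_trans ?_ (mul_le_mul_of_nonneg_left h zero_le_two)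
  rw [div_le_iff₀ ha, one_sub_div hb.ne', ← mul_div_assoc, div_mul_eq_mul_div, le_div_iff₀ hb]
  rcases le_total b (2 * a) with h | h
  · nlinarith [min_le_left (b - a) a]
  · nlinarith [min_le_right (b - a) a]

lemma sub_div_le_log {a b : ℝ} (ha : 0 < a) (hab : a ≤ b) :
    (b - a) / b ≤ 2 * (Real.log b - Real.log a) := by
  have hb := ha.trans_le hab
  have h := Real.one_sub_inv_le_log_of_pos (div_pos hb ha)
  rw [Real.log_div hb.ne' ha.ne', inv_div, one_sub_div hb.ne'] at h
  have := div_nonneg (sub_nonneg.2 hab) hb.le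
  linarith

variable {Γ ι : Type*} [Group Γ] [DecidableEq Γ] [DecidableEq ι]

/-- The logarithm of the inverse density in `B` of the set of points reachable over `U`. -/
noncomputable def logDeficit (p : ι → Γ) (B : Finset Γ) (b : Γ) (U : Finset ι) : ℝ :=
  Real.log B.card - Real.log (reachable p B b U).card

lemma card_movedInto_div_le (p : ι → Γ) {B : Finset Γ} {b : Γ} (hb : b ∈ B) (U : Finset ι)
    (i : ι) {s : ℤ} (hs : s = 1 ∨ s = -1) :
    ((movedInto (p i ^ s) (reachable p B b U) (B \ reachable p B b U)).card : ℝ) /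
      (reachable p B b U).card ≤
        2 * (logDeficit p B b (U.erase i) - logDeficit p B b (insert i U)) := by
  have hpos : ∀ V : Finset ι, (0 : ℝ) < (reachable p B b V).card := fun V => by
    exact_mod_cast Finset.card_pos.2 ⟨b, self_mem_reachable p hb _⟩
  unfold logDeficit
  rw [sub_sub_sub_cancel_left]
  by_cases hi : i ∈ U
  · rw [Finset.insert_eq_of_mem hi]
    have hsub : reachable p B b (U.erase i) ⊆ reachable p B b U :=
      reachable_mono p B b (Finset.coe_subset.2 (Finset.erase_subset _ _))
    refine le_trans ?_ (sub_div_le_log (hpos _) (by exact_mod_cast Finset.card_le_card hsub))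
    gcongr
    rw [← Nat.cast_sub (Finset.card_le_card hsub), ← Finset.card_sdiff_of_subset hsub]
    norm_cast
    refine Finset.card_le_card fun r hr => ?_
    simp only [movedInto, Finset.mem_filter, Finset.mem_sdiff] at hr ⊢
    refine ⟨hr.1, fun h => hr.2.2 ?_⟩
    have := mul_zpow_mem_reachable (by simp) hs h hr.2.1
    rwa [← Finset.coe_insert, Finset.insert_erase hi] at this
  · rw [Finset.erase_eq_of_notMem hi]
    have hsub : reachable p B b U ⊆ reachable p B b ((insert i U : Finset ι) : Set ι) :=
      reachable_mono p B b (Finset.coe_subset.2 (Finset.subset_insert _ _))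
    refine le_trans ?_ (min_sub_div_le_log (hpos _) (by exact_mod_cast Finset.card_le_card hsub))
    gcongr
    refine le_min ?_ (by exact_mod_cast Finset.card_le_card (Finset.filter_subset _ _))
    rw [← Nat.cast_sub (Finset.card_le_card hsub), ← Finset.card_sdiff_of_subset hsub]
    norm_cast
    refine Finset.card_le_card_of_injOn (· * p i ^ s) (fun r hr => ?_)
      (mul_left_injective _).injOn
    simp only [movedInto, Finset.mem_coe, Finset.mem_filter, Finset.mem_sdiff] at hr ⊢
    refine ⟨?_, hr.2.2⟩
    rw [Finset.coe_insert]
    exact mul_zpow_mem_reachable (by simpa using hi) hs hr.1 hr.2.1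

lemma mul_logDeficit_le [Fintype ι] (p : ι → Γ) {k : ℝ} (hk : 0 ≤ k) {B : Finset Γ}
    (hmin : ∀ R ⊆ B, R.Nonempty → penalizedBoundary p k B ≤ penalizedBoundary p k R)
    {b : Γ} (hb : b ∈ B) (U : Finset ι) :
    k / 4 * logDeficit p B b U ≤
      ∑ i, (logDeficit p B b (U.erase i) - logDeficit p B b (insert i U)) := by
  have hne : (reachable p B b U).Nonempty := ⟨b, self_mem_reachable p hb _⟩
  have hpos : (0 : ℝ) < (reachable p B b U).card := by exact_mod_cast hne.card_pos
  have h := isoperimetry_of_minimal p hk hmin (reachable_subset p B b U) hne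
  have h₁ : k * logDeficit p B b U ≤
      ∑ i, 4 * (logDeficit p B b (U.erase i) - logDeficit p B b (insert i U)) := by
    refine le_trans ?_ (Finset.sum_le_sum (f := fun i =>
      (((movedInto (p i) (reachable p B b U) (B \ reachable p B b U)).card : ℝ) +
        (movedInto (p i)⁻¹ (reachable p B b U) (B \ reachable p B b U)).card) /
          (reachable p B b U).card) fun i _ => ?_)
    · rw [← Finset.sum_div, le_div_iff₀ hpos]
      exact le_trans (le_of_eq (by unfold logDeficit; ring)) h
    · have h₂ := card_movedInto_div_le p hb U i (s := 1) (Or.inl rfl)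
      have h₃ := card_movedInto_div_le p hb U i (s := -1) (Or.inr rfl)
      rw [zpow_one] at h₂
      rw [zpow_neg_one] at h₃
      rw [add_div]
      linarith
  rw [← Finset.mul_sum] at h₁
  linarith

/-- A finite set cannot be approximately invariant under too many dissociated translations. -/
theorem IsDissociatedFamily.mul_card_le [Fintype ι] {p : ι → Γ} (hp : IsDissociatedFamily p)
    {A : Finset Γ} (hA : A.Nonempty) {c k : ℝ} (hk : 0 ≤ k)
    (hout : ∀ i, ((movedOut (p i) A).card : ℝ) ≤ (1 - c) * A.card)
    (hlog : 2 * (Real.exp (-(k / 8)) * Real.log A.card) < Real.log (4 / 3)) :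
    c * Fintype.card ι ≤ k * Real.log A.card := by
  by_contra! hlt
  obtain ⟨B, hBA, hB, hBle, hmin⟩ := exists_minimal_penalizedBoundary p k hA
  have hBpos : (0 : ℝ) < B.card := by exact_mod_cast hB.card_pos
  have hApos : (0 : ℝ) < A.card := by exact_mod_cast hA.card_pos
  obtain ⟨b, hb⟩ := hB
  have hone : B.card ≠ 1 := by
    intro h1
    obtain ⟨a, rfl⟩ := Finset.card_eq_one.1 h1
    have hp1 : ∀ i, p i ≠ 1 := fun i => by
      simpa [wordProd] using hp [(i, 1)] (by simp)
        ((isSignedWord_singleton i (Or.inl rfl)).mono (Set.subset_univ _))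
    have h₁ : penalizedBoundary p k {a} = Fintype.card ι := by
      simp [penalizedBoundary, movedOut, Finset.filter_singleton, hp1]
    have h₂ : penalizedBoundary p k A ≤ k * Real.log A.card + (1 - c) * Fintype.card ι := by
      unfold penalizedBoundary
      gcongr
      rw [div_le_iff₀ hApos]
      refine (Finset.sum_le_sum fun i _ => hout i).trans (le_of_eq ?_)
      simp
      ring
    linarith
  obtain ⟨U, hU⟩ := exists_add_compl_le (mul_logDeficit_le p hk hmin hb)
  have hx : logDeficit p B b ∅ ≤ Real.log A.card := by
    have h₁ : (0 : ℝ) ≤ Real.log (reachable p B b (∅ : Finset ι)).card := Real.log_natCast_nonneg _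
    have h₂ : Real.log B.card ≤ Real.log A.card :=
      Real.log_le_log hBpos (by exact_mod_cast Finset.card_le_card hBA)
    unfold logDeficit
    linarith
  have hsmall : logDeficit p B b U + logDeficit p B b Uᶜ < Real.log (4 / 3) := by
    refine hU.trans_lt (lt_of_le_of_lt ?_ hlog)
    rw [show k / 4 / 2 = k / 8 by ring]
    gcongr
  have hnonneg : ∀ V, 0 ≤ logDeficit p B b V := fun V => by
    refine sub_nonneg.2 (Real.log_le_log ?_ ?_)
    · exact_mod_cast Finset.card_pos.2 ⟨b, self_mem_reachable p hb _⟩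
    · exact_mod_cast Finset.card_le_card (reachable_subset p B b _)
  have hbig : ∀ V, logDeficit p B b V < Real.log (4 / 3) →
      3 * B.card < 4 * (reachable p B b V).card := fun V hV => by
    have hR : (0 : ℝ) < (reachable p B b V).card := by
      exact_mod_cast Finset.card_pos.2 ⟨b, self_mem_reachable p hb _⟩
    rw [logDeficit, ← Real.log_div hBpos.ne' hR.ne',
      Real.log_lt_log_iff (div_pos hBpos hR) (by norm_num), div_lt_div_iff₀ hR (by norm_num)] at hV
    exact_mod_cast (by linarith : (3 * B.card : ℝ) < 4 * (reachable p B b V).card)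
  have h₁ := hbig U (by linarith [hnonneg Uᶜ])
  have h₂ := hbig Uᶜ (by linarith [hnonneg U])
  have h₃ := Finset.card_le_card (Finset.union_subset (reachable_subset p B b U)
    (reachable_subset p B b (Uᶜ : Finset ι)))
  have h₄ := Finset.card_union_add_card_inter (reachable p B b U)
    (reachable p B b (Uᶜ : Finset ι))
  have hle : (reachable p B b U ∩ reachable p B b (Uᶜ : Finset ι)).card ≤ 1 := by
    refine Finset.card_le_one_iff_subset_singleton.2 ⟨b, fun y hy => ?_⟩
    rw [Finset.mem_inter] at hy
    rw [Finset.mem_singleton]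
    exact eq_of_mem_reachable_of_disjoint hp
      (Finset.disjoint_coe.2 disjoint_compl_right) hy.1 hy.2
  have := Finset.card_pos.2 ⟨b, hb⟩
  omega

end LogDeficit

section Pairs

lemma mul_card_le_mul_card_biUnion {α β : Type*} [DecidableEq α] [DecidableEq β]
    (f : α → Finset β) {n M : ℕ} (T : Finset α) (hf : ∀ a ∈ T, (f a).card = n)
    (hM : ∀ a ∈ T, ∀ b ∈ T, a ≠ b → M * (f a ∩ f b).card ≤ n) :
    2 * M * T.card * n + T.card * n ≤ 2 * M * (T.biUnion f).card + T.card * T.card * n := by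
  induction T using Finset.induction_on with
  | empty => simp
  | insert a T ha ih =>
    have h := ih (fun b hb => hf b (Finset.mem_insert_of_mem hb)) fun b hb c hc =>
      hM b (Finset.mem_insert_of_mem hb) c (Finset.mem_insert_of_mem hc)
    have h₁ : M * (f a ∩ T.biUnion f).card ≤ T.card * n := by
      rw [Finset.inter_biUnion]
      calc M * (T.biUnion fun b => f a ∩ f b).card
          ≤ M * ∑ b ∈ T, (f a ∩ f b).card := Nat.mul_le_mul_left _ Finset.card_biUnion_le
        _ = ∑ b ∈ T, M * (f a ∩ f b).card := Finset.mul_sum _ _ _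
        _ ≤ T.card * n := by
          rw [← smul_eq_mul]
          refine Finset.sum_le_card_nsmul _ _ _ fun b hb => ?_
          exact hM a (Finset.mem_insert_self _ _) b (Finset.mem_insert_of_mem hb)
            fun hab => ha (hab ▸ hb)
    have h₂ := Finset.card_union_add_card_inter (f a) (T.biUnion f)
    rw [hf a (Finset.mem_insert_self _ _)] at h₂
    rw [Finset.card_insert_of_notMem ha, Finset.biUnion_insert]
    have h₃ := congrArg (M * ·) h₂
    simp only [mul_add] at h₃
    nlinarith

variable {Γ : Type*} [Group Γ] [DecidableEq Γ]

lemma card_movedOut_add_card_inter (A : Finset Γ) (g h : Γ) :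
    (movedOut (g * h⁻¹) A).card + (A.image (· * g) ∩ A.image (· * h)).card = A.card := by
  rw [← Finset.card_filter_add_card_filter_not (s := A) fun a => a * (g * h⁻¹) ∈ A, add_comm]
  congr 1
  refine Finset.card_nbij' (· * g⁻¹) (· * g) ?_ ?_ ?_ ?_ <;>
    simp +contextual [Set.MapsTo, Set.LeftInvOn, mul_assoc]

lemma exists_pair_card_movedOut_le {K : ℕ} (hK : 0 < K) {A T : Finset Γ} (hA : A.Nonempty)
    (hAA : (A * A).card ≤ K * A.card) (hTA : T ⊆ A) (hT : T.card = 2 * K) :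
    ∃ g ∈ T, ∃ h ∈ T, g ≠ h ∧
      ((movedOut (g * h⁻¹) A).card : ℝ) ≤ (1 - 1 / (2 * K)) * A.card := by
  obtain ⟨g, hg, h, hh, hne, hlt⟩ : ∃ g ∈ T, ∃ h ∈ T, g ≠ h ∧
      A.card < 2 * K * (A.image (· * g) ∩ A.image (· * h)).card := by
    by_contra! hc
    have h₁ := mul_card_le_mul_card_biUnion (fun g => A.image (· * g)) T
      (fun g _ => Finset.card_image_of_injective _ (mul_left_injective g)) hc
    have h₂ : (T.biUnion fun g => A.image (· * g)).card ≤ (A * A).card := by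
      refine Finset.card_le_card (Finset.biUnion_subset.2 fun g hg => ?_)
      exact Finset.image_subset_iff.2 fun a ha => Finset.mul_mem_mul ha (hTA hg)
    have h₃ := Nat.mul_le_mul_left (2 * (2 * K)) (h₂.trans hAA)
    have h₄ := Nat.mul_pos hK hA.card_pos
    rw [hT] at h₁
    nlinarith
  refine ⟨g, hg, h, hh, hne, ?_⟩
  have hsum : ((movedOut (g * h⁻¹) A).card : ℝ) +
      (A.image (· * g) ∩ A.image (· * h)).card = A.card := by
    exact_mod_cast card_movedOut_add_card_inter A g h
  have hlt' : (A.card : ℝ) < 2 * K * (A.image (· * g) ∩ A.image (· * h)).card := by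
    exact_mod_cast hlt
  have hK' : (0 : ℝ) < 2 * K := by positivity
  have : 1 / (2 * K : ℝ) * A.card ≤ (A.image (· * g) ∩ A.image (· * h)).card := by
    rw [one_div_mul_eq_div, div_le_iff₀ hK']
    linarith
  linarith

/-- If every subset of `D` of size `k` contains a pair related by `Q`, then disjoint related
pairs can be extracted from `D` as long as `k` points remain. -/
lemma exists_disjoint_pairs {α : Type*} [DecidableEq α] {Q : α → α → Prop} {k : ℕ} (m : ℕ)
    (D : Finset α) (hQ : ∀ T ⊆ D, T.card = k → ∃ g ∈ T, ∃ h ∈ T, g ≠ h ∧ Q g h)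
    (hm : 2 * m + k ≤ D.card) :
    ∃ g h : Fin m → α, Function.Injective (Sum.elim g h) ∧ (∀ i, g i ∈ D) ∧ (∀ i, h i ∈ D) ∧
      ∀ i, Q (g i) (h i) := by
  induction m generalizing D with
  | zero => exact ⟨Fin.elim0, Fin.elim0, by simp [Function.Injective], by simp⟩
  | succ m ih =>
    obtain ⟨T, hTD, hT⟩ := Finset.exists_subset_card_eq (by omega : k ≤ D.card)
    obtain ⟨a, ha, b, hb, hab, hQab⟩ := hQ T hTD hT
    have hcard : D.card ≤ ((D.erase a).erase b).card + 2 := by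
      have h₁ := Finset.pred_card_le_card_erase (s := D) (a := a)
      have h₂ := Finset.pred_card_le_card_erase (s := D.erase a) (a := b)
      omega
    have hsub : (D.erase a).erase b ⊆ D :=
      (Finset.erase_subset _ _).trans (Finset.erase_subset _ _)
    obtain ⟨g, h, hinj, hg, hh, hgh⟩ := ih _ (fun T' hT' => hQ T' (hT'.trans hsub)) (by omega)
    rw [Sum.elim_injective] at hinj
    simp only [Finset.mem_erase] at hg hh
    refine ⟨Fin.cons a g, Fin.cons b h, ?_, ?_, ?_, ?_⟩
    · rw [Sum.elim_injective]
      refine ⟨Fin.cons_injective_iff.2 ⟨?_, hinj.1⟩, Fin.cons_injective_iff.2 ⟨?_, hinj.2.1⟩, ?_⟩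
      · rintro ⟨i, hi⟩
        exact (hg i).2.1 hi
      · rintro ⟨i, hi⟩
        exact (hh i).1 hi
      · refine Fin.cases (Fin.cases ?_ fun j => ?_) fun i => Fin.cases ?_ fun j => ?_
        · simpa using hab
        · simpa using (hh j).2.1.symm
        · simpa using (hg i).1
        · simpa using hinj.2.2 i j
    · exact Fin.cases (by simpa using hTD ha) fun i => by simpa using (hg i).2.2
    · exact Fin.cases (by simpa using hTD hb) fun i => by simpa using (hh i).2.2
    · exact Fin.cases (by simpa using hQab) fun i => by simpa using hgh i

end Pairs

section ExpandWord

variable {Γ ι : Type*}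

/-- Rewrite a signed word in the quotients `g i * (h i)⁻¹` as a word in the `g i` and `h i`. -/
def expandWord (g h : ι → Γ) (l : List (ι × ℤ)) : List (Γ × ℤ) :=
  l.flatMap fun q => if q.2 = 1 then [(g q.1, 1), (h q.1, -1)] else [(h q.1, 1), (g q.1, -1)]

lemma mem_expandWord {g h : ι → Γ} {l : List (ι × ℤ)} {q : Γ × ℤ}
    (hq : q ∈ expandWord g h l) :
    (∃ r ∈ l, q.1 = g r.1 ∨ q.1 = h r.1) ∧ (q.2 = 1 ∨ q.2 = -1) := by
  obtain ⟨r, hr, hqr⟩ := List.mem_flatMap.1 hq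
  split_ifs at hqr <;> simp only [List.mem_cons, List.not_mem_nil, or_false] at hqr <;>
    rcases hqr with rfl | rfl <;> exact ⟨⟨r, hr, by simp⟩, by simp⟩

lemma nodup_expandWord {g h : ι → Γ} (hinj : Function.Injective (Sum.elim g h))
    {l : List (ι × ℤ)} (hl : (l.map Prod.fst).Nodup) :
    ((expandWord g h l).map Prod.fst).Nodup := by
  rw [Sum.elim_injective] at hinj
  obtain ⟨hg, hh, hgh⟩ := hinj
  induction l with
  | nil => simp [expandWord]
  | cons q l ih =>
    rw [List.map_cons, List.nodup_cons] at hl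
    have hsplit : expandWord g h (q :: l) = (if q.2 = 1 then [(g q.1, 1), (h q.1, -1)]
      else [(h q.1, 1), (g q.1, -1)]) ++ expandWord g h l := rfl
    rw [hsplit, List.map_append]
    refine List.Nodup.append ?_ (ih hl.2) ?_
    · split_ifs <;> simp [hgh, (hgh _ _).symm]
    · intro x hx hx'
      obtain ⟨y, hy, rfl⟩ := List.mem_map.1 hx'
      obtain ⟨⟨r, hr, hyr⟩, -⟩ := mem_expandWord hy
      have hne : q.1 ≠ r.1 := fun heq => hl.1 (heq ▸ List.mem_map_of_mem hr)
      have hx : y.1 = g q.1 ∨ y.1 = h q.1 := by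
        split_ifs at hx <;> simp at hx <;> tauto
      rcases hx with hx | hx <;> rcases hyr with hy | hy <;> rw [hx] at hy
      exacts [hne (hg hy), hgh _ _ hy, hgh _ _ hy.symm, hne (hh hy)]

lemma prod_expandWord [Group Γ] (g h : ι → Γ) {l : List (ι × ℤ)}
    (hl : ∀ q ∈ l, q.2 = 1 ∨ q.2 = -1) :
    ((expandWord g h l).map fun q => q.1 ^ q.2).prod = wordProd (fun i => g i * (h i)⁻¹) l := by
  induction l with
  | nil => simp [expandWord, wordProd]
  | cons q l ih =>
    have ih := ih fun r hr => hl r (List.mem_cons_of_mem _ hr)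
    simp only [expandWord, wordProd, List.flatMap_cons, List.map_append, List.prod_append,
      List.map_cons, List.prod_cons] at ih ⊢
    rw [ih]
    rcases hl q List.mem_cons_self with h1 | h1 <;> simp [h1]

lemma IsDissociatedMul.isDissociatedFamily [Group Γ] {D : Set Γ} (hD : IsDissociatedMul D)
    {g h : ι → Γ} (hinj : Function.Injective (Sum.elim g h)) (hg : ∀ i, g i ∈ D)
    (hh : ∀ i, h i ∈ D) : IsDissociatedFamily fun i => g i * (h i)⁻¹ := by
  intro l hne hl
  rw [← prod_expandWord g h hl.2.2]
  refine hD _ ?_ (nodup_expandWord hinj hl.1) ?_ fun q hq => (mem_expandWord hq).2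
  · obtain ⟨q, l, rfl⟩ := List.exists_cons_of_ne_nil hne
    simp only [expandWord, List.flatMap_cons]
    split_ifs <;> simp
  · intro q hq
    obtain ⟨r, -, h | h⟩ := (mem_expandWord hq).1 <;> rw [h]
    exacts [hg _, hh _]

end ExpandWord

/-- For every positive integer `K` there are `C > 0` and `n₀` such that for every
group `Γ` and every finite `A ⊆ Γ` with `|A| ≥ n₀` and `|A·A| ≤ K |A|`, every dissociated
subset of `A` has size at most `C log |A| log log |A|`. -/
theorem additive_dimension_small_doubling_general (K : ℕ) (hK : 0 < K) :
    ∃ C > (0 : ℝ), ∃ n₀ : ℕ, ∀ (Γ : Type*) [Group Γ] [DecidableEq Γ] (A : Finset Γ),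
      n₀ ≤ A.card → (A * A).card ≤ K * A.card →
      ∀ S : Finset Γ, ↑S ⊆ (A : Set Γ) → IsDissociatedMul (S : Set Γ) →
        (S.card : ℝ) ≤ C * Real.log A.card * Real.log (Real.log A.card) := by
  refine ⟨131 * K, by positivity, 16, ?_⟩
  intro Γ _ _ A hn hAA S hSA hS
  have hK1 : (1 : ℝ) ≤ K := by exact_mod_cast hK
  have hA : A.Nonempty := Finset.card_pos.1 (by omega)
  set L := Real.log A.card with hL
  have hexp : Real.exp 1 ≤ L := by
    have h₁ : Real.log 16 ≤ L := Real.log_le_log (by norm_num) (by exact_mod_cast hn)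
    have h₂ : Real.log 16 = 4 * Real.log 2 := by
      rw [show (16 : ℝ) = 2 ^ 4 by norm_num, Real.log_pow]
      norm_num
    linarith [Real.exp_one_lt_d9, Real.log_two_gt_d9]
  have hLpos : 0 < L := (Real.exp_pos 1).trans_le hexp
  have hL1 : 1 ≤ L := by linarith [Real.add_one_le_exp (1 : ℝ)]
  have hLL : 1 ≤ Real.log L := (Real.le_log_iff_exp_le hLpos).2 hexp
  have hprod : 1 ≤ L * Real.log L := one_le_mul_of_one_le_of_one_le hL1 hLL
  rcases lt_or_ge S.card (2 * K) with hsmall | hlarge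
  · have : (S.card : ℝ) < 2 * K := by exact_mod_cast hsmall
    nlinarith
  obtain ⟨m, hm, hm'⟩ : ∃ m, 2 * m + 2 * K ≤ S.card ∧ S.card ≤ 2 * m + 2 * K + 1 :=
    ⟨(S.card - 2 * K) / 2, by omega, by omega⟩
  obtain ⟨g, h, hinj, hg, hh, hgh⟩ := exists_disjoint_pairs m S
    (Q := fun g h => ((movedOut (g * h⁻¹) A).card : ℝ) ≤ (1 - 1 / (2 * K)) * A.card)
    (fun T hT => exists_pair_card_movedOut_le hK hA hAA (hT.trans hSA)) hm
  have hlog : 2 * (Real.exp (-(8 * (Real.log L + 3) / 8)) * L) < Real.log (4 / 3) := by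
    have h₁ : Real.exp (-(8 * (Real.log L + 3) / 8)) * L = (Real.exp 3)⁻¹ := by
      rw [mul_div_cancel_left₀ _ (by norm_num : (8 : ℝ) ≠ 0), Real.exp_neg, Real.exp_add,
        Real.exp_log hLpos]
      field_simp
    have h₂ := Real.one_sub_inv_le_log_of_pos (by norm_num : (0 : ℝ) < 4 / 3)
    have h₃ : 8 < Real.exp 3 := by
      have : Real.exp 3 = Real.exp 1 ^ 3 := by rw [← Real.exp_nat_mul]; norm_num
      rw [this]
      calc (8 : ℝ) = 2 ^ 3 := by norm_num
        _ < Real.exp 1 ^ 3 := by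
          gcongr
          linarith [Real.exp_one_gt_d9]
    have h₄ : (Real.exp 3)⁻¹ < 8⁻¹ := inv_strictAnti₀ (by norm_num) h₃
    rw [h₁]
    norm_num at h₂ h₄ ⊢
    linarith
  have hmain := (hS.isDissociatedFamily hinj hg hh).mul_card_le hA (by positivity) hgh hlog
  rw [Fintype.card_fin, one_div_mul_eq_div, div_le_iff₀ (by positivity)] at hmain
  have hS' : (S.card : ℝ) ≤ 2 * m + 2 * K + 1 := by exact_mod_cast hm'
  have h₁ : 8 * (Real.log L + 3) * L * (2 * K) ≤ 64 * K * (L * Real.log L) := by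
    have : 0 ≤ 16 * (K * L) * (3 * (Real.log L - 1)) := by
      have := sub_nonneg.2 hLL
      positivity
    linarith
  have h₂ : (2 * K + 1 : ℝ) ≤ 3 * K * (L * Real.log L) := by nlinarith
  linarith
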